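/- Let q₀, q₁ : X → [0,∞) be measurable and let χ : Ω → H be measurable and symmetric. Then, as an identity in [0,∞], ∫_{Ω × Ω} ‖χ(υ ⊔ κ)‖² q₀^⊗(υ) q₁^⊗(κ) d(μ ⊗ μ)(υ, κ) = ∫_Ω ‖χ(ϑ)‖² (q₀ + q₁)^⊗(ϑ) dμ(ϑ). (This is the isometry property ‖Δχ‖(q₀, q₁) = ‖χ‖(q₀ + q₁) of the multiple point splitter Δ defined by (Δχ)(υ, κ) = χ(υ ⊔ κ), from the weighted Fock space with weight q₀ + q₁ into the tensor product of those with weights q₀ and q₁.) -/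

import Mathlib

open MeasureTheory ENNReal
open scoped NNReal

noncomputable section

/-- The Guichardet space over `X`. -/
abbrev GS (X : Type*) := Σ n : ℕ, Fin n → X

/-- The Guichardet measure `μ = ∑ₙ (1/n!)·(Sigma.mk n)_* λ^{⊗n}`. -/
def guichardetMeasure {X : Type*} [MeasurableSpace X] (lam : Measure X) : Measure (GS X) :=
  Measure.sum fun n =>
    ((n.factorial : ℝ≥0∞))⁻¹ • Measure.map (Sigma.mk n) (Measure.pi fun _ : Fin n => lam)

/-- The product weight `q^⊗(n,x) = ∏ᵢ q(xᵢ)`. -/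
def prodWeight {X : Type*} (q : X → ℝ≥0) (ϑ : GS X) : ℝ≥0∞ :=
  ∏ i : Fin ϑ.1, (q (ϑ.2 i) : ℝ≥0∞)

/-- A function on the Guichardet space is symmetric if it is invariant under permutations
of the coordinates. -/
def SymmFun {X E : Type*} (χ : GS X → E) : Prop :=
  ∀ (n : ℕ) (σ : Equiv.Perm (Fin n)) (x : Fin n → X), χ ⟨n, x ∘ σ⟩ = χ ⟨n, x⟩

/-- Concatenation `υ ⊔ κ` of two elements of the Guichardet space. -/
def GS.concat {X : Type*} : GS X → GS X → GS X
  | ⟨m, y⟩, ⟨k, z⟩ => ⟨m + k, Fin.append y z⟩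

theorem measurableEmbedding_sigmaMk {ι : Type*} {β : ι → Type*} [∀ i, MeasurableSpace (β i)]
    (i : ι) : MeasurableEmbedding (Sigma.mk i : β i → Sigma β) where
  injective := sigma_mk_injective
  measurable := measurable_iff_le_map.2 (iInf_le _ i)
  measurableSet_image' := by
    intro s hs
    refine MeasurableSpace.measurableSet_iInf.2 fun j => ?_
    change MeasurableSet (Sigma.mk j ⁻¹' (Sigma.mk i '' s))
    by_cases h : i = j
    · subst h
      rwa [Set.preimage_image_eq _ sigma_mk_injective]
    · rw [Set.preimage_image_sigmaMk_of_ne (Ne.symm h)]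
      exact MeasurableSet.empty

theorem lintegral_guichardetMeasure {X : Type*} [MeasurableSpace X] (lam : Measure X)
    (f : GS X → ℝ≥0∞) :
    ∫⁻ ϑ, f ϑ ∂(guichardetMeasure lam) =
      ∑' n : ℕ, (n.factorial : ℝ≥0∞)⁻¹ * ∫⁻ x, f ⟨n, x⟩ ∂(Measure.pi fun _ : Fin n => lam) := by
  simp only [guichardetMeasure, lintegral_sum_measure, lintegral_smul_measure, smul_eq_mul,
    (measurableEmbedding_sigmaMk _).lintegral_map]

theorem lintegral_guichardetMeasure_prod {X : Type*} [MeasurableSpace X] (lam : Measure X)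
    [SigmaFinite lam] (f : GS X × GS X → ℝ≥0∞) :
    ∫⁻ p, f p ∂((guichardetMeasure lam).prod (guichardetMeasure lam)) =
      ∑' p : ℕ × ℕ, (p.1.factorial : ℝ≥0∞)⁻¹ * (p.2.factorial : ℝ≥0∞)⁻¹ *
        ∫⁻ z, f (⟨p.1, z.1⟩, ⟨p.2, z.2⟩)
          ∂((Measure.pi fun _ : Fin p.1 => lam).prod (Measure.pi fun _ : Fin p.2 => lam)) := by
  have hemb (m k : ℕ) : MeasurableEmbedding (Prod.map
      (Sigma.mk (β := fun n => Fin n → X) m) (Sigma.mk (β := fun n => Fin n → X) k)) :=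
    (measurableEmbedding_sigmaMk m).prodMap (measurableEmbedding_sigmaMk k)
  simp only [guichardetMeasure, ← Measure.map_smul]
  rw [Measure.prod_sum, lintegral_sum_measure]
  refine tsum_congr fun p => ?_
  rw [Measure.map_prod_map _ _ (measurableEmbedding_sigmaMk _).measurable
    (measurableEmbedding_sigmaMk _).measurable, (hemb _ _).lintegral_map,
    Measure.prod_smul_left, Measure.prod_smul_right, lintegral_smul_measure,
    lintegral_smul_measure, smul_eq_mul, smul_eq_mul, mul_assoc]
  rfl

theorem lintegral_pi_eq_lintegral_prod {X α β γ : Type*} [Fintype α] [Fintype β] [Fintype γ]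
    [MeasurableSpace X] (lam : Measure X) [SigmaFinite lam] (e : α ⊕ β ≃ γ)
    (g : (γ → X) → ℝ≥0∞) :
    ∫⁻ x, g x ∂(Measure.pi fun _ : γ => lam) =
      ∫⁻ z : (α → X) × (β → X), g (Sum.elim z.1 z.2 ∘ e.symm)
        ∂((Measure.pi fun _ : α => lam).prod (Measure.pi fun _ : β => lam)) := by
  rw [(measurePreserving_piCongrLeft (fun _ : γ => lam) e).lintegral_map_equiv,
    (measurePreserving_sumPiEquivProdPi_symm
      (fun _ : α ⊕ β => lam)).lintegral_map_equiv]
  refine lintegral_congr fun z => congrArg g ?_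
  funext i
  obtain ⟨j, rfl⟩ := e.surjective i
  rw [MeasurableEquiv.coe_piCongrLeft, Equiv.piCongrLeft_apply_apply]
  cases j <;> simp [MeasurableEquiv.sumPiEquivProdPi]

theorem SymmFun.apply_sumElim_comp {X E : Type*} {χ : GS X → E} (hχ : SymmFun χ) {m k n : ℕ}
    (e : Fin n ≃ Fin m ⊕ Fin k) (y : Fin m → X) (z : Fin k → X) :
    χ ⟨n, Sum.elim y z ∘ e⟩ = χ (GS.concat ⟨m, y⟩ ⟨k, z⟩) := by
  obtain rfl : n = m + k := by simpa using Fintype.card_congr e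
  rw [GS.concat, ← hχ _ (e.trans finSumFinEquiv) (Fin.append y z)]
  congr 2
  funext i
  simp only [Function.comp_apply, Equiv.trans_apply]
  cases e i <;> simp

/-- The integral of a symmetric function against a weight taking `q₀` on a set `s` of coordinates
and `q₁` on its complement depends only on the cardinality of `s`. -/
theorem SymmFun.lintegral_mul_prod_mul_prod_compl {X : Type*} [MeasurableSpace X]
    (lam : Measure X) [SigmaFinite lam] (q₀ q₁ : X → ℝ≥0) {f : GS X → ℝ≥0∞} (hf : SymmFun f)
    {m k n : ℕ} {s : Finset (Fin n)} (hm : s.card = m) (hk : sᶜ.card = k) :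
    ∫⁻ x, f ⟨n, x⟩ * ((∏ i ∈ s, (q₀ (x i) : ℝ≥0∞)) * ∏ i ∈ sᶜ, (q₁ (x i) : ℝ≥0∞))
        ∂(Measure.pi fun _ : Fin n => lam) =
      ∫⁻ z, f (GS.concat ⟨m, z.1⟩ ⟨k, z.2⟩) * prodWeight q₀ ⟨m, z.1⟩ * prodWeight q₁ ⟨k, z.2⟩
        ∂((Measure.pi fun _ : Fin m => lam).prod (Measure.pi fun _ : Fin k => lam)) := by
  rw [lintegral_pi_eq_lintegral_prod lam (finSumEquivOfFinset hm hk)]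
  refine lintegral_congr fun z => ?_
  rw [hf.apply_sumElim_comp, mul_assoc]
  congr 2
  · refine (Finset.prod_bij (fun i _ => finSumEquivOfFinset hm hk (Sum.inl i)) ?_ ?_ ?_ ?_).symm
    · intro i _
      simp [Finset.orderEmbOfFin_mem]
    · intro i _ j _ h
      simpa using h
    · intro i hi
      obtain ⟨j, rfl⟩ := (finSumEquivOfFinset hm hk).surjective i
      rcases j with j | j
      · exact ⟨j, Finset.mem_univ _, rfl⟩
      · rw [finSumEquivOfFinset_inr] at hi
        exact absurd hi (Finset.mem_compl.1 (Finset.orderEmbOfFin_mem _ hk j))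
    · intro i _
      rw [Function.comp_apply, Equiv.symm_apply_apply, Sum.elim_inl]
  · refine (Finset.prod_bij (fun i _ => finSumEquivOfFinset hm hk (Sum.inr i)) ?_ ?_ ?_ ?_).symm
    · intro i _
      rw [finSumEquivOfFinset_inr]
      exact Finset.orderEmbOfFin_mem _ hk i
    · intro i _ j _ h
      simpa using h
    · intro i hi
      obtain ⟨j, rfl⟩ := (finSumEquivOfFinset hm hk).surjective i
      rcases j with j | j
      · rw [finSumEquivOfFinset_inl] at hi
        exact absurd (Finset.orderEmbOfFin_mem _ hm j) (Finset.mem_compl.1 hi)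
      · exact ⟨j, Finset.mem_univ _, rfl⟩
    · intro i _
      rw [Function.comp_apply, Equiv.symm_apply_apply, Sum.elim_inr]

theorem SymmFun.lintegral_mul_prodWeight_add {X : Type*} [MeasurableSpace X]
    (lam : Measure X) [SigmaFinite lam] {q₀ q₁ : X → ℝ≥0} (hq₀ : Measurable q₀)
    (hq₁ : Measurable q₁) {f : GS X → ℝ≥0∞} (hf : SymmFun f) (hfm : Measurable f) (n : ℕ) :
    ∫⁻ x, f ⟨n, x⟩ * prodWeight (q₀ + q₁) ⟨n, x⟩ ∂(Measure.pi fun _ : Fin n => lam) =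
      ∑ p ∈ Finset.HasAntidiagonal.antidiagonal n, n.choose p.1 • ∫⁻ z,
        f (GS.concat ⟨p.1, z.1⟩ ⟨p.2, z.2⟩) * prodWeight q₀ ⟨p.1, z.1⟩ * prodWeight q₁ ⟨p.2, z.2⟩
        ∂((Measure.pi fun _ : Fin p.1 => lam).prod (Measure.pi fun _ : Fin p.2 => lam)) := by
  have hfn : Measurable fun x : Fin n → X => f ⟨n, x⟩ :=
    hfm.comp (measurableEmbedding_sigmaMk n).measurable
  simp only [prodWeight, Pi.add_apply, ENNReal.coe_add, Fintype.prod_add, Finset.mul_sum]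
  rw [lintegral_finsetSum Finset.univ (f := fun (s : Finset (Fin n)) (x : Fin n → X) =>
      f ⟨n, x⟩ * ((∏ i ∈ s, (q₀ (x i) : ℝ≥0∞)) * ∏ i ∈ sᶜ, (q₁ (x i) : ℝ≥0∞)))
      fun s _ => hfn.mul (by fun_prop)]
  have hs (s : Finset (Fin n)) :=
    hf.lintegral_mul_prod_mul_prod_compl lam q₀ q₁ (s := s) rfl
      (by rw [Finset.card_compl, Fintype.card_fin])
  simp only [hs]
  rw [← Finset.powerset_univ, Finset.sum_powerset_apply_card (fun m => ∫⁻ z,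
      f (GS.concat ⟨m, z.1⟩ ⟨n - m, z.2⟩) * prodWeight q₀ ⟨m, z.1⟩ * prodWeight q₁ ⟨n - m, z.2⟩
      ∂((Measure.pi fun _ : Fin m => lam).prod (Measure.pi fun _ : Fin (n - m) => lam))),
    Finset.Nat.sum_antidiagonal_eq_sum_range_succ_mk, Finset.card_univ, Fintype.card_fin]
  rfl

theorem ENNReal.inv_factorial_add_mul_choose (m k : ℕ) :
    ((m + k).factorial : ℝ≥0∞)⁻¹ * ((m + k).choose m : ℝ≥0∞) =
      (m.factorial : ℝ≥0∞)⁻¹ * (k.factorial : ℝ≥0∞)⁻¹ := by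
  have hne (n : ℕ) : (n.factorial : ℝ≥0∞) ≠ 0 := Nat.cast_ne_zero.2 n.factorial_ne_zero
  have htop (n : ℕ) : (n.factorial : ℝ≥0∞) ≠ ∞ := ENNReal.natCast_ne_top _
  have hc : ((m + k).choose m : ℝ≥0∞) ≠ 0 :=
    Nat.cast_ne_zero.2 (Nat.choose_pos (Nat.le_add_right m k)).ne'
  rw [← Nat.add_choose_mul_factorial_mul_factorial m k, ← Nat.choose_symm_add,
    Nat.cast_mul, Nat.cast_mul, mul_assoc,
    ENNReal.mul_inv (.inl hc) (.inl (ENNReal.natCast_ne_top _)), mul_right_comm,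
    ENNReal.inv_mul_cancel hc (ENNReal.natCast_ne_top _), one_mul,
    ENNReal.mul_inv (.inl (hne m)) (.inl (htop m))]

/-- The isometry property `‖Δχ‖(q₀,q₁) = ‖χ‖(q₀+q₁)` of the multiple point splitter
`(Δχ)(υ,κ) = χ(υ ⊔ κ)`. -/
theorem stmt3 {X : Type*} [MeasurableSpace X] (lam : Measure X) [SigmaFinite lam]
    {H : Type*} [NormedAddCommGroup H] [InnerProductSpace ℂ H] [MeasurableSpace H] [BorelSpace H]
    (q₀ q₁ : X → ℝ≥0) (hq₀ : Measurable q₀) (hq₁ : Measurable q₁)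
    (χ : GS X → H) (hχ : Measurable χ) (hχs : SymmFun χ) :
    ∫⁻ p : GS X × GS X,
        (‖χ (GS.concat p.1 p.2)‖₊ : ℝ≥0∞) ^ 2 * prodWeight q₀ p.1 * prodWeight q₁ p.2
      ∂((guichardetMeasure lam).prod (guichardetMeasure lam))
      = ∫⁻ ϑ : GS X, (‖χ ϑ‖₊ : ℝ≥0∞) ^ 2 * prodWeight (q₀ + q₁) ϑ ∂(guichardetMeasure lam) := by
  let f : GS X → ℝ≥0∞ := fun ϑ => (‖χ ϑ‖₊ : ℝ≥0∞) ^ 2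
  have hf : SymmFun f := fun n σ x => by simp only [f, hχs n σ x]
  have hfm : Measurable f := (measurable_coe_nnreal_ennreal.comp hχ.nnnorm).pow_const 2
  rw [lintegral_guichardetMeasure_prod, lintegral_guichardetMeasure,
    ← Finset.HasAntidiagonal.sigmaAntidiagonalEquivProd.tsum_eq, ENNReal.tsum_sigma']
  refine tsum_congr fun n => ?_
  rw [hf.lintegral_mul_prodWeight_add lam hq₀ hq₁ hfm n, Finset.mul_sum, tsum_fintype,
    Finset.univ_eq_attach, ← Finset.sum_attach (Finset.HasAntidiagonal.antidiagonal n)]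
  refine Finset.sum_congr rfl fun p _ => ?_
  obtain ⟨⟨m, k⟩, hp⟩ := p
  obtain rfl : m + k = n := Finset.HasAntidiagonal.mem_antidiagonal.1 hp
  rw [nsmul_eq_mul, ← mul_assoc, ENNReal.inv_factorial_add_mul_choose]
  rfl
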